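/- Let G be a finite connected Helly graph, let x, y be vertices with dist(x,y) = 2r − 1 for some integer r ≥ 1, and let z be a vertex with dist(z,x) = dist(z,y) = r. Then there exist adjacent vertices a ∈ L(x, r−1, y) and b ∈ L(y, r−1, x) such that z is adjacent to both a and b. -/

import Mathlib

open SimpleGraph

variable {V : Type*}

/-- The ball of radius `r` centered at `v`. -/
def gBall (G : SimpleGraph V) (v : V) (r : ℕ) : Set V := {u | G.dist v u ≤ r}

/-- A graph is Helly if every (nonempty) family of pairwise intersecting balls
has a nonempty common intersection. -/
def IsHelly (G : SimpleGraph V) : Prop :=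
  ∀ F : Set (V × ℕ), F.Nonempty →
    (∀ p ∈ F, ∀ q ∈ F, (gBall G p.1 p.2 ∩ gBall G q.1 q.2).Nonempty) →
    (⋂ p ∈ F, gBall G p.1 p.2).Nonempty

/-- The eccentricity of a vertex. -/
noncomputable def ecc (G : SimpleGraph V) [Fintype V] (v : V) : ℕ :=
  Finset.univ.sup (fun u => G.dist v u)

/-- The radius of a graph. -/
noncomputable def grad (G : SimpleGraph V) [Fintype V] : ℕ :=
  sInf (Set.range (ecc G))

/-- The diameter of a graph. -/
noncomputable def gdiam (G : SimpleGraph V) [Fintype V] : ℕ :=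
  Finset.univ.sup (ecc G)

/-- The center of a graph: vertices of minimum eccentricity. -/
noncomputable def gcenter (G : SimpleGraph V) [Fintype V] : Set V :=
  {v | ecc G v = grad G}

/-- Distance from a vertex to a set of vertices. -/
noncomputable def distS (G : SimpleGraph V) (v : V) (S : Set V) : ℕ :=
  sInf (G.dist v '' S)

/-- The metric projection of a vertex onto a set of vertices. -/
noncomputable def proj (G : SimpleGraph V) (v : V) (S : Set V) : Set V :=
  {s ∈ S | G.dist v s = distS G v S}

/-- The slice `L(u,k,v)`: vertices on the metric interval from `u` to `v`
at distance `k` from `u`. -/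
def gslice (G : SimpleGraph V) (u : V) (k : ℕ) (v : V) : Set V :=
  {w | G.dist u w = k ∧ G.dist u w + G.dist w v = G.dist u v}

/-- A graph is `C₄`-free if it has no induced cycle on four vertices. -/
def C4Free (G : SimpleGraph V) : Prop :=
  ¬ ∃ a b c d : V, a ≠ b ∧ a ≠ c ∧ a ≠ d ∧ b ≠ c ∧ b ≠ d ∧ c ≠ d ∧
    G.Adj a b ∧ G.Adj b c ∧ G.Adj c d ∧ G.Adj d a ∧ ¬ G.Adj a c ∧ ¬ G.Adj b d

/-- The open neighbourhood of a set: vertices outside it with a neighbour in it. -/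
def nbhdSet (G : SimpleGraph V) (C : Set V) : Set V :=
  {v | v ∉ C ∧ ∃ c ∈ C, G.Adj v c}

lemma gBall_inter_gBall_nonempty {G : SimpleGraph V} (hconn : G.Connected) {u v : V} {p q : ℕ}
    (h : G.dist u v ≤ p + q) : (gBall G u p ∩ gBall G v q).Nonempty := by
  obtain ⟨w, hw⟩ := hconn.exists_walk_length_eq_dist u v
  refine ⟨w.getVert p, ?_, ?_⟩
  · exact (dist_le (w.take p)).trans (by simp [Walk.take_length])
  · rw [gBall, Set.mem_ofPred_eq, dist_comm]
    refine (dist_le (w.drop p)).trans ?_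
    rw [Walk.drop_length]
    omega

lemma IsHelly.exists_mem_three_gBalls {G : SimpleGraph V} (hH : IsHelly G) (hconn : G.Connected)
    {u v w : V} {p q s : ℕ} (huv : G.dist u v ≤ p + q) (huw : G.dist u w ≤ p + s)
    (hvw : G.dist v w ≤ q + s) :
    ∃ c, G.dist u c ≤ p ∧ G.dist v c ≤ q ∧ G.dist w c ≤ s := by
  obtain ⟨c, hc⟩ := hH {(u, p), (v, q), (w, s)} ⟨(u, p), by simp⟩ (by
    have hvu := huv
    have hwu := huw
    have hwv := hvw
    rw [dist_comm] at hvu hwu hwv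
    rintro a (rfl | rfl | rfl) b (rfl | rfl | rfl) <;>
      exact gBall_inter_gBall_nonempty hconn (by dsimp only; first | omega | simp))
  simp only [Set.mem_iInter] at hc
  exact ⟨c, hc (u, p) (by simp), hc (v, q) (by simp), hc (w, s) (by simp)⟩

/-- In a finite connected Helly graph, if `dist(x,y) = 2r − 1` for
some `r ≥ 1` and `dist(z,x) = dist(z,y) = r`, then `z` has two adjacent
neighbours `a ∈ L(x, r−1, y)` and `b ∈ L(y, r−1, x)`. -/
theorem stmt15 (G : SimpleGraph V) [Fintype V] (hconn : G.Connected) (hH : IsHelly G)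
    (x y z : V) (r : ℕ) (hr : 1 ≤ r) (hxy : G.dist x y = 2 * r - 1)
    (hzx : G.dist z x = r) (hzy : G.dist z y = r) :
    ∃ a ∈ gslice G x (r - 1) y, ∃ b ∈ gslice G y (r - 1) x,
      G.Adj a b ∧ G.Adj z a ∧ G.Adj z b := by
  obtain ⟨a, hxa, hya, hza⟩ := hH.exists_mem_three_gBalls hconn (u := x) (v := y) (w := z)
    (p := r - 1) (q := r) (s := 1) (by omega) (by rw [dist_comm]; omega) (by rw [dist_comm]; omega)
  obtain ⟨b, hyb, hzb, hab⟩ := hH.exists_mem_three_gBalls hconn (u := y) (v := z) (w := a)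
    (p := r - 1) (q := 1) (s := 1) (by rw [dist_comm]; omega) (by omega) (by omega)
  have hxay : G.dist x y ≤ G.dist x a + G.dist a y := hconn.dist_triangle
  have hxby : G.dist x y ≤ G.dist x b + G.dist b y := hconn.dist_triangle
  have hxab : G.dist x b ≤ G.dist x a + G.dist a b := hconn.dist_triangle
  have hay : G.dist a y = G.dist y a := dist_comm
  have hby : G.dist b y = G.dist y b := dist_comm
  have hbx : G.dist b x = G.dist x b := dist_comm
  have hyx : G.dist y x = G.dist x y := dist_comm
  have hzx' : G.dist x z = G.dist z x := dist_comm
  have hzy' : G.dist y z = G.dist z y := dist_comm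
  have adj_of_dist_le {u v : V} (h : G.dist u v ≤ 1) (hne : u ≠ v) : G.Adj u v := by
    have := hconn.pos_dist_of_ne hne
    exact dist_eq_one_iff_adj.mp (by omega)
  refine ⟨a, ⟨by omega, by omega⟩, b, ⟨by omega, by omega⟩,
    adj_of_dist_le hab ?_, adj_of_dist_le hza ?_, adj_of_dist_le hzb ?_⟩ <;>
  · rintro rfl
    omega
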